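/- Let n ≥ 2 and let S : skew(n) → skew(n) be a linear map such that S(qAqᵀ) = q S(A) qᵀ for every q ∈ O(n) and A ∈ skew(n). Then there exists a constant c ∈ ℝ such that S(A) = c·A for all A ∈ skew(n). -/

import Mathlib

open Matrix

/-- The space `skew(n)` of skew-symmetric real `n × n` matrices. -/
def Skew (n : ℕ) : Submodule ℝ (Matrix (Fin n) (Fin n) ℝ) where
  carrier := {A | Aᵀ = -A}
  add_mem' := by
    intro a b ha hb
    simp only [Set.mem_setOf_eq] at *
    rw [Matrix.transpose_add, ha, hb, neg_add]
  zero_mem' := by simp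
  smul_mem' := by
    intro c A hA
    simp only [Set.mem_setOf_eq] at *
    rw [Matrix.transpose_smul, hA, smul_neg]

lemma conj_mem {n : ℕ} (q : Matrix (Fin n) (Fin n) ℝ) {A : Matrix (Fin n) (Fin n) ℝ}
    (hA : A ∈ Skew n) : q * A * qᵀ ∈ Skew n := by
  have h : Aᵀ = -A := hA
  show (q * A * qᵀ)ᵀ = -(q * A * qᵀ)
  rw [Matrix.transpose_mul, Matrix.transpose_mul, Matrix.transpose_transpose, h]
  simp [Matrix.mul_assoc]

/-- Conjugation `A ↦ q A qᵀ` on skew-symmetric matrices. -/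
def conjS {n : ℕ} (q : Matrix (Fin n) (Fin n) ℝ) (A : Skew n) : Skew n :=
  ⟨q * A.val * qᵀ, conj_mem q A.2⟩

/-- `x ∧ y := y xᵀ − x yᵀ`. -/
def wedge {n : ℕ} (x y : Fin n → ℝ) : Matrix (Fin n) (Fin n) ℝ :=
  Matrix.vecMulVec y x - Matrix.vecMulVec x y

lemma wedge_mem {n : ℕ} (x y : Fin n → ℝ) : wedge x y ∈ Skew n := by
  show (wedge x y)ᵀ = -(wedge x y)
  ext i j
  simp [wedge, Matrix.vecMulVec_apply, Matrix.transpose_apply, Matrix.sub_apply, Matrix.neg_apply]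
  ring

/-- `x ∧ y` as an element of `skew(n)`. -/
def wedgeS {n : ℕ} (x y : Fin n → ℝ) : Skew n := ⟨wedge x y, wedge_mem x y⟩

lemma comm_mem {n : ℕ} {A B : Matrix (Fin n) (Fin n) ℝ} (hA : A ∈ Skew n) (hB : B ∈ Skew n) :
    A * B - B * A ∈ Skew n := by
  have hA' : Aᵀ = -A := hA
  have hB' : Bᵀ = -B := hB
  show (A * B - B * A)ᵀ = -(A * B - B * A)
  rw [Matrix.transpose_sub, Matrix.transpose_mul, Matrix.transpose_mul, hA', hB']
  simp [neg_sub]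

/-- The commutator `AB − BA` as an element of `skew(n)`. -/
def commS {n : ℕ} (A B : Skew n) : Skew n :=
  ⟨A.val * B.val - B.val * A.val, comm_mem A.2 B.2⟩

lemma Skew.apply_swap {n : ℕ} (A : Skew n) (k l : Fin n) : A.val k l = -A.val l k :=
  congrFun (congrFun (show A.valᵀ = -A.val from A.2) l) k

lemma Skew.apply_self {n : ℕ} (A : Skew n) (k : Fin n) : A.val k k = 0 := by
  have := Skew.apply_swap A k k
  linarith

lemma conjS_wedgeS {n : ℕ} (q : Matrix (Fin n) (Fin n) ℝ) (x y : Fin n → ℝ) :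
    conjS q (wedgeS x y) = wedgeS (q *ᵥ x) (q *ᵥ y) := by
  apply Subtype.ext
  simp [conjS, wedgeS, wedge, Matrix.mul_sub, Matrix.sub_mul, mul_vecMulVec, vecMulVec_mul,
    vecMul_transpose]

/-- A skew-symmetric matrix is a combination of wedges of standard basis vectors. -/
lemma Skew.eq_sum_wedgeS {n : ℕ} (A : Skew n) :
    A = ∑ i, ∑ j, (A.val i j / 2) • wedgeS (Pi.single j 1) (Pi.single i 1) := by
  apply Subtype.ext
  ext k l
  have h := Skew.apply_swap A k l
  simp [wedgeS, wedge, Matrix.sum_apply, vecMulVec_apply, Pi.single_apply, mul_sub,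
    Finset.sum_sub_distrib]
  linarith

/-- Conjugating by the reflection in the `k`-th coordinate hyperplane. -/
lemma equivariant_wedgeS_apply_eq_zero {n : ℕ} {S : Skew n →ₗ[ℝ] Skew n}
    (hS : ∀ q : Matrix (Fin n) (Fin n) ℝ, qᵀ * q = 1 →
        ∀ A : Skew n, S (conjS q A) = conjS q (S A))
    {i j k : Fin n} (hi : k ≠ i) (hj : k ≠ j) (l : Fin n) :
    (S (wedgeS (Pi.single i 1) (Pi.single j 1))).val k l = 0 := by
  rcases eq_or_ne k l with rfl | hl
  · exact Skew.apply_self _ _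
  let d : Fin n → ℝ := fun m => if m = k then -1 else 1
  have hd : (diagonal d)ᵀ * diagonal d = 1 := by
    rw [diagonal_transpose, diagonal_mul_diagonal, ← diagonal_one]
    congr 1
    ext m
    by_cases h : m = k <;> simp [d, h]
  have h := hS (diagonal d) hd (wedgeS (Pi.single i 1) (Pi.single j 1))
  rw [conjS_wedgeS] at h
  have hfix : ∀ m, k ≠ m → diagonal d *ᵥ Pi.single m 1 = Pi.single m 1 := by
    intro m hm
    ext a
    by_cases ha : a = m
    · subst ha
      simp [d, hm.symm, mulVec_diagonal]
    · simp [ha, mulVec_diagonal]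
  rw [hfix i hi, hfix j hj] at h
  have hentry := congrArg (fun B : Skew n => B.val k l) h
  simp [conjS, d, hl.symm, diagonal_transpose] at hentry
  linarith

/-- Conjugating by a permutation matrix. -/
lemma equivariant_wedgeS_apply_perm {n : ℕ} {S : Skew n →ₗ[ℝ] Skew n}
    (hS : ∀ q : Matrix (Fin n) (Fin n) ℝ, qᵀ * q = 1 →
        ∀ A : Skew n, S (conjS q A) = conjS q (S A))
    (σ : Equiv.Perm (Fin n)) (i j : Fin n) :
    (S (wedgeS (Pi.single (σ i) 1) (Pi.single (σ j) 1))).val (σ j) (σ i) =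
      (S (wedgeS (Pi.single i 1) (Pi.single j 1))).val j i := by
  let q : Matrix (Fin n) (Fin n) ℝ := (1 : Matrix (Fin n) (Fin n) ℝ).submatrix σ id
  have hq : qᵀ * q = 1 := by
    simp [q, transpose_submatrix, submatrix_mul_equiv]
  have h := hS q hq (wedgeS (Pi.single (σ i) 1) (Pi.single (σ j) 1))
  have hv : ∀ m, q *ᵥ Pi.single (σ m) 1 = Pi.single m 1 := by
    intro m
    ext a
    simp [q, one_apply, Pi.single_apply]
  rw [conjS_wedgeS, hv, hv] at h
  rw [h]
  simp [conjS, q, mul_apply, one_apply]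

/-- Up to a scalar, `S` fixes wedges of distinct basis vectors. -/
lemma equivariant_wedgeS_eq_smul {n : ℕ} {S : Skew n →ₗ[ℝ] Skew n}
    (hS : ∀ q : Matrix (Fin n) (Fin n) ℝ, qᵀ * q = 1 →
        ∀ A : Skew n, S (conjS q A) = conjS q (S A))
    {i j : Fin n} (hij : i ≠ j) :
    S (wedgeS (Pi.single i 1) (Pi.single j 1)) =
      (S (wedgeS (Pi.single i 1) (Pi.single j 1))).val j i •
        wedgeS (Pi.single i 1) (Pi.single j 1) := by
  have hz := fun k (hi : k ≠ i) (hj : k ≠ j) l => equivariant_wedgeS_apply_eq_zero hS hi hj l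
  generalize S (wedgeS (Pi.single i 1) (Pi.single j 1)) = B at hz ⊢
  apply Subtype.ext
  ext k l
  have hskew := Skew.apply_swap B k l
  have hk := hz k
  have hl := hz l
  have hdiag := Skew.apply_self B k
  simp only [wedgeS, wedge, Submodule.coe_smul, Matrix.smul_apply, Matrix.sub_apply, vecMulVec_apply,
    Pi.single_apply, smul_eq_mul]
  grind

/-- Lemma (a) on invariant tensors: for `n ≥ 2`, every linear map `S : skew(n) → skew(n)`
commuting with conjugation by every `q ∈ O(n)` is a scalar multiple of the identity. -/
theorem equivariant_endomorphism_of_skew_is_scalar (n : ℕ) (hn : 2 ≤ n)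
    (S : Skew n →ₗ[ℝ] Skew n)
    (hS : ∀ q : Matrix (Fin n) (Fin n) ℝ, qᵀ * q = 1 →
        ∀ A : Skew n, S (conjS q A) = conjS q (S A)) :
    ∃ c : ℝ, ∀ A : Skew n, S A = c • A := by
  have hpair : (⟨0, by omega⟩ : Fin n) ≠ ⟨1, by omega⟩ := by simp
  generalize (⟨0, by omega⟩ : Fin n) = a at hpair
  generalize (⟨1, by omega⟩ : Fin n) = b at hpair
  refine ⟨(S (wedgeS (Pi.single a 1) (Pi.single b 1))).val b a, fun A => ?_⟩
  have hE : ∀ i j : Fin n, S (wedgeS (Pi.single i 1) (Pi.single j 1)) =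
      (S (wedgeS (Pi.single a 1) (Pi.single b 1))).val b a •
        wedgeS (Pi.single i 1) (Pi.single j 1) := by
    intro i j
    rcases eq_or_ne i j with rfl | hij
    · have h0 : wedgeS (Pi.single i 1) (Pi.single i 1) = (0 : Skew n) :=
        Subtype.ext (sub_self _)
      rw [h0, map_zero, smul_zero]
    · obtain ⟨σ, rfl, rfl⟩ := MulAction.is_two_pretransitive_iff.mp
        (Equiv.Perm.isMultiplyPretransitive (Fin n) 2) hpair hij
      rw [equivariant_wedgeS_eq_smul hS hij]
      congr 1
      exact equivariant_wedgeS_apply_perm hS σ a b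
  generalize (S (wedgeS (Pi.single a 1) (Pi.single b 1))).val b a = c at hE ⊢
  conv_lhs => rw [Skew.eq_sum_wedgeS A]
  conv_rhs => rw [Skew.eq_sum_wedgeS A]
  simp only [map_sum, map_smul, hE, Finset.smul_sum]
  exact Finset.sum_congr rfl fun i _ => Finset.sum_congr rfl fun j _ => smul_comm _ _ _
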